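/- arXiv:1912.02919 — 2 statements merged into one kernel-verified Lean document; each statement's English description precedes it below -/
import Mathlib

section
/- Gaussian mechanism: fix a dimension d ≥ 1, real numbers ε ∈ (0, 1), δ ∈ (0, 1), Δ > 0, and σ > 0 with σ ≥ √(2 ln(1.25/δ)) · Δ / ε. Let x, y : Fin d → ℝ satisfy √(Σᵢ (xᵢ − yᵢ)²) ≤ Δ, and let μ = ⊗ᵢ N(xᵢ, σ²) and ν = ⊗ᵢ N(yᵢ, σ²) be the corresponding Gaussian product measures on ℝ^d with covariance σ²·I. Then for every measurable set E ⊆ ℝ^d, μ(E) ≤ e^ε · ν(E) + δ. -/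
open MeasureTheory ProbabilityTheory

lemma gm_half : gaussianReal 0 1 (Set.Ioi 0) ≤ ENNReal.ofReal (1 / 2) := by
  have h1 : gaussianReal 0 1 (Set.Iio 0) = gaussianReal 0 1 (Set.Ioi 0) := by
    have h := gaussianReal_map_neg (μ := 0) (v := 1)
    rw [neg_zero] at h
    conv_lhs => rw [← h]
    rw [Measure.map_apply measurable_neg measurableSet_Iio]
    congr 1
    ext z
    simp
  have h2 : gaussianReal 0 1 (Set.Iio 0 ∪ Set.Ioi 0) ≤ 1 := prob_le_one
  rw [measure_union (by
    rw [Set.disjoint_left]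
    intro z hz hz'
    exact lt_asymm (Set.mem_Iio.mp hz) (Set.mem_Ioi.mp hz')) measurableSet_Ioi, h1, ← two_mul] at h2
  rw [ENNReal.ofReal_div_of_pos (by norm_num), ENNReal.ofReal_one,
    ENNReal.le_div_iff_mul_le (by simp) (by simp), mul_comm]
  simpa using h2

lemma gm_tail (t : ℝ) (ht : 0 ≤ t) :
    gaussianReal 0 1 (Set.Ioi t) ≤ ENNReal.ofReal (Real.exp (-t ^ 2 / 2) * (1 / 2)) := by
  have h1 : gaussianReal 0 1 (Set.Ioi t) = gaussianReal (-t) 1 (Set.Ioi 0) := by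
    have h := gaussianReal_map_sub_const (μ := 0) (v := 1) t
    rw [zero_sub] at h
    rw [← h, Measure.map_apply (by fun_prop) measurableSet_Ioi]
    congr 1
    ext z
    simp
  rw [h1, gaussianReal_apply _ one_ne_zero]
  calc ∫⁻ z in Set.Ioi 0, gaussianPDF (-t) 1 z
      ≤ ∫⁻ z in Set.Ioi 0, ENNReal.ofReal (Real.exp (-t ^ 2 / 2)) * gaussianPDF 0 1 z := by
        refine setLIntegral_mono' measurableSet_Ioi fun z hz => ?_
        have hz : 0 < z := hz
        rw [gaussianPDF, gaussianPDF, ← ENNReal.ofReal_mul (Real.exp_pos _).le]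
        apply ENNReal.ofReal_le_ofReal
        rw [gaussianPDFReal, gaussianPDFReal, mul_left_comm, ← Real.exp_add]
        gcongr
        simp only [NNReal.coe_one]
        nlinarith [mul_nonneg ht hz.le]
    _ = ENNReal.ofReal (Real.exp (-t ^ 2 / 2)) * gaussianReal 0 1 (Set.Ioi 0) := by
        rw [lintegral_const_mul _ (measurable_gaussianPDF _ _), gaussianReal_apply _ one_ne_zero]
    _ ≤ _ := by
        rw [ENNReal.ofReal_mul (Real.exp_pos _).le]
        gcongr
        exact gm_half

lemma gm_tail_neg (t : ℝ) (ht : -(1 / 5) ≤ t) :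
    gaussianReal 0 1 (Set.Ioi t) ≤ ENNReal.ofReal (7 / 10) := by
  have hsub : Set.Ioi t ⊆ Set.Ioc (-(1 / 5)) 0 ∪ Set.Ioi 0 := by
    intro z hz
    have hz : t < z := hz
    rcases le_or_gt z 0 with h | h
    · left; exact ⟨by linarith, h⟩
    · right; exact h
  have h1 : gaussianReal 0 1 (Set.Ioc (-(1 / 5)) 0) ≤ ENNReal.ofReal (1 / 5) := by
    rw [gaussianReal_apply _ one_ne_zero]
    calc ∫⁻ z in Set.Ioc (-(1 / 5)) 0, gaussianPDF 0 1 z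
        ≤ ∫⁻ z in Set.Ioc (-(1 / 5) : ℝ) 0, 1 := by
          refine lintegral_mono fun z => ?_
          rw [gaussianPDF, ENNReal.ofReal_le_one, gaussianPDFReal]
          have hp : 1 ≤ Real.sqrt (2 * Real.pi * ((1 : NNReal) : ℝ)) := by
            rw [Real.one_le_sqrt]
            simp only [NNReal.coe_one]
            linarith [Real.pi_gt_three]
          have he : Real.exp (-(z - 0) ^ 2 / (2 * ((1 : NNReal) : ℝ))) ≤ 1 := by
            rw [Real.exp_le_one_iff]
            simp only [NNReal.coe_one]
            nlinarith [sq_nonneg (z - 0)]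
          exact mul_le_one₀ (inv_le_one_of_one_le₀ hp) (Real.exp_pos _).le he
      _ = _ := by simp
  calc _ ≤ gaussianReal 0 1 (Set.Ioc (-(1 / 5)) 0) + gaussianReal 0 1 (Set.Ioi 0) :=
        (measure_mono hsub).trans (measure_union_le _ _)
    _ ≤ ENNReal.ofReal (1 / 5) + ENNReal.ofReal (1 / 2) := add_le_add h1 gm_half
    _ = _ := by
        rw [← ENNReal.ofReal_add (by norm_num) (by norm_num)]
        norm_num

lemma gm_law (d : ℕ) (v : NNReal) (x b : Fin d → ℝ) (hb : ∑ i, (b i) ^ 2 * (v : ℝ) = 1) :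
    (Measure.pi fun i => gaussianReal (x i) v).map (fun z => ∑ i, (z i - x i) * b i)
      = gaussianReal 0 1 := by
  have h1 : ∀ i, (gaussianReal (x i) v).map (fun z => (z - x i) * b i)
      = gaussianReal 0 (NNReal.mk ((b i) ^ 2) (sq_nonneg _) * v) := by
    intro i
    have : (fun z : ℝ => (z - x i) * b i) = (fun z => z * b i) ∘ (fun z => z - x i) := rfl
    rw [this, ← Measure.map_map (by fun_prop) (by fun_prop), gaussianReal_map_sub_const,
      gaussianReal_map_mul_const]
    simp
  have h2 : (Measure.pi fun i => gaussianReal (x i) v).map (fun z => ∑ i, (z i - x i) * b i)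
      = (Measure.pi fun i => gaussianReal 0 (NNReal.mk ((b i) ^ 2) (sq_nonneg _) * v)).map
        (fun p => ∑ i, p i) := by
    simp_rw [← h1]
    rw [← Measure.pi_map_pi (fun i => by fun_prop), Measure.map_map (by fun_prop) (by fun_prop)]
    rfl
  rw [h2]
  have : IsProbabilityMeasure ((Measure.pi fun i => gaussianReal 0 (NNReal.mk ((b i) ^ 2) (sq_nonneg _) * v)).map
        (fun p => ∑ i, p i)) := Measure.isProbabilityMeasure_map (by fun_prop)
  apply Measure.ext_of_charFun
  rw [charFun_map_sum_pi_eq_prod]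
  ext t
  rw [Finset.prod_apply]
  simp_rw [charFun_gaussianReal, ← Complex.exp_sum]
  congr 1
  have hb' : ∑ i, ((b i : ℂ)) ^ 2 * ((v : ℝ) : ℂ) = 1 := by exact_mod_cast hb
  simp only [Complex.ofReal_zero, mul_zero, zero_mul, zero_sub, NNReal.coe_mul,
    Complex.ofReal_mul, NNReal.coe_mk, Complex.ofReal_pow, NNReal.coe_one, Complex.ofReal_one]
  rw [Finset.sum_neg_distrib, ← Finset.sum_div, ← Finset.sum_mul, hb']

lemma gm_density1 (v : NNReal) (hv : v ≠ 0) (x y : ℝ) :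
    gaussianReal x v = (gaussianReal y v).withDensity
      (fun z => ENNReal.ofReal (Real.exp (((z - y) ^ 2 - (z - x) ^ 2) / (2 * v)))) := by
  rw [gaussianReal_of_var_ne_zero _ hv, gaussianReal_of_var_ne_zero _ hv,
    ← withDensity_mul _ (measurable_gaussianPDF _ _) (by fun_prop)]
  congr 1
  ext z
  rw [Pi.mul_apply, gaussianPDF, gaussianPDF, ← ENNReal.ofReal_mul (gaussianPDFReal_nonneg _ _ _),
    gaussianPDFReal, gaussianPDFReal, mul_assoc (Real.sqrt _)⁻¹, ← Real.exp_add]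
  congr 3
  ring

lemma gm_density (d : ℕ) (v : NNReal) (hv : v ≠ 0) (x y : Fin d → ℝ) :
    (Measure.pi fun i => gaussianReal (x i) v) =
      (Measure.pi fun i => gaussianReal (y i) v).withDensity
      (fun z => ∏ i, ENNReal.ofReal (Real.exp (((z i - y i) ^ 2 - (z i - x i) ^ 2) / (2 * v)))) := by
  apply Measure.pi_eq
  intro s hs
  rw [withDensity_apply _ (MeasurableSet.univ_pi hs), ← lintegral_indicator (MeasurableSet.univ_pi hs)]
  have hm : ∀ i, Measurable ((s i).indicator (fun z : ℝ =>
      ENNReal.ofReal (Real.exp (((z - y i) ^ 2 - (z - x i) ^ 2) / (2 * v))))) :=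
    fun i => Measurable.indicator (by fun_prop) (hs i)
  have h1 : ∀ z : Fin d → ℝ, (Set.univ.pi s).indicator (fun z : Fin d → ℝ =>
      ∏ i, ENNReal.ofReal (Real.exp (((z i - y i) ^ 2 - (z i - x i) ^ 2) / (2 * v)))) z
      = ∏ i, (s i).indicator (fun z : ℝ =>
      ENNReal.ofReal (Real.exp (((z - y i) ^ 2 - (z - x i) ^ 2) / (2 * v)))) (z i) := by
    intro z
    by_cases hz : z ∈ Set.univ.pi s
    · rw [Set.indicator_of_mem hz]
      refine Finset.prod_congr rfl fun i _ => ?_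
      rw [Set.indicator_of_mem (hz i (Set.mem_univ i))]
    · rw [Set.indicator_of_notMem hz]
      simp only [Set.mem_pi, Set.mem_univ, true_implies, not_forall] at hz
      obtain ⟨i, hi⟩ := hz
      exact (Finset.prod_eq_zero (Finset.mem_univ i) (Set.indicator_of_notMem hi _)).symm
  simp_rw [h1]
  have hind := iIndepFun_pi (μ := fun i => gaussianReal (y i) v) (fun i => (hm i).aemeasurable)
  have := lintegral_prod_eq_prod_lintegral_of_indepFun Finset.univ _ hind
    (fun i => (hm i).comp (measurable_pi_apply i))
  rw [this]
  refine Finset.prod_congr rfl fun i _ => ?_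
  rw [gm_density1 v hv (x i) (y i), withDensity_apply _ (hs i), ← lintegral_indicator (hs i)]
  exact (measurePreserving_eval (fun i => gaussianReal (y i) v) i).lintegral_comp (hm i)

lemma gm_num (ε δ k : ℝ) (hε : ε ∈ Set.Ioo (0 : ℝ) 1) (hδ : δ ∈ Set.Ioo (0 : ℝ) 1)
    (hk : Real.sqrt (2 * Real.log (1.25 / δ)) ≤ k) :
    gaussianReal 0 1 (Set.Ioi (k - ε / (2 * k))) ≤ ENNReal.ofReal δ := by
  obtain ⟨hε0, hε1⟩ := hε
  obtain ⟨hδ0, hδ1⟩ := hδ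
  have hlog : 1 / 5 ≤ Real.log (1.25 / δ) := by
    have h := Real.one_sub_inv_le_log_of_pos (x := 1.25 / δ) (by positivity)
    rw [inv_div] at h
    norm_num at h ⊢
    linarith
  have hkk : 2 * Real.log (1.25 / δ) ≤ k ^ 2 := Real.sqrt_le_iff.mp hk |>.2
  have hk0 : 0 ≤ k := Real.sqrt_le_iff.mp hk |>.1
  have hk1 : 3 / 5 ≤ k := by nlinarith
  have hδe : 1.25 * Real.exp (-k ^ 2 / 2) ≤ δ := by
    have h : Real.exp (-k ^ 2 / 2) ≤ Real.exp (- Real.log (1.25 / δ)) :=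
      Real.exp_le_exp.mpr (by linarith)
    rw [Real.exp_neg, Real.exp_log (by positivity), inv_div] at h
    norm_num at h ⊢
    linarith
  set t := k - ε / (2 * k) with ht
  have hq : 2 * k * (ε / (2 * k)) = ε := by field_simp
  rcases le_or_gt 0 t with h | h
  · refine (gm_tail t h).trans (ENNReal.ofReal_le_ofReal (le_trans ?_ hδe))
    have h2 : Real.exp (-t ^ 2 / 2) ≤ Real.exp (-k ^ 2 / 2) * Real.exp (1 / 2) := by
      rw [← Real.exp_add]
      apply Real.exp_le_exp.mpr
      have : t ^ 2 = k ^ 2 - ε + (ε / (2 * k)) ^ 2 := by rw [ht]; linear_combination -hq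
      nlinarith [sq_nonneg (ε / (2 * k))]
    have h3 : Real.exp (1 / 2) ≤ 2 := by
      have := Real.exp_one_lt_d9
      have h4 : Real.exp (1 / 2) * Real.exp (1 / 2) = Real.exp 1 := by
        rw [← Real.exp_add]; norm_num
      nlinarith [Real.exp_pos (1 / 2)]
    have := Real.exp_pos (-k ^ 2 / 2)
    norm_num
    nlinarith
  · have hq' : ε / (2 * k) ≤ k + 1 / 5 := by
      rw [div_le_iff₀ (by positivity)]
      nlinarith
    refine (gm_tail_neg t (by linarith)).trans (ENNReal.ofReal_le_ofReal ?_)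
    have hk2 : k ^ 2 ≤ 1 / 2 := by nlinarith
    have := Real.add_one_le_exp (-k ^ 2 / 2)
    norm_num at hδe
    linarith

/-- **The Gaussian mechanism is (ε, δ)-differentially private.** If
`σ ≥ √(2 ln(1.25/δ)) · Δ / ε` with `ε, δ ∈ (0,1)` and the means `x, y ∈ ℝ^d`
satisfy `‖x − y‖₂ ≤ Δ`, then the Gaussian product measures with means `x`, `y`
and covariance `σ²·I` satisfy `μ(E) ≤ e^ε ν(E) + δ` for every measurable `E`. -/
theorem gaussian_mechanism
    (d : ℕ) (hd : 1 ≤ d) (ε δ Δ σ : ℝ)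
    (hε : ε ∈ Set.Ioo (0 : ℝ) 1) (hδ : δ ∈ Set.Ioo (0 : ℝ) 1)
    (hΔ : 0 < Δ) (hσ : 0 < σ)
    (hσ_big : Real.sqrt (2 * Real.log (1.25 / δ)) * Δ / ε ≤ σ)
    (x y : Fin d → ℝ)
    (hxy : Real.sqrt (∑ i, (x i - y i) ^ 2) ≤ Δ) :
    ∀ E : Set (Fin d → ℝ), MeasurableSet E →
      (Measure.pi fun i => gaussianReal (x i) ⟨σ ^ 2, sq_nonneg σ⟩) E ≤
        ENNReal.ofReal (Real.exp ε) *
          (Measure.pi fun i => gaussianReal (y i) ⟨σ ^ 2, sq_nonneg σ⟩) E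
          + ENNReal.ofReal δ := by
  intro E hE
  obtain ⟨v, hv⟩ : ∃ v : NNReal, v = ⟨σ ^ 2, sq_nonneg σ⟩ := ⟨_, rfl⟩
  rw [← hv]
  have hvσ : (v : ℝ) = σ ^ 2 := by rw [hv]; rfl
  have hv0 : v ≠ 0 := by
    intro h
    rw [h] at hvσ
    have : 0 < σ ^ 2 := by positivity
    simp at hvσ
    linarith
  clear hv
  set n := Real.sqrt (∑ i, (x i - y i) ^ 2) with hn
  have hn0 : 0 ≤ n := Real.sqrt_nonneg _
  have hn2 : n ^ 2 = ∑ i, (x i - y i) ^ 2 :=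
    Real.sq_sqrt (Finset.sum_nonneg fun i _ => sq_nonneg _)
  have hε0 := hε.1
  rcases hn0.eq_or_lt with h0 | hnpos
  · have hx : x = y := by
      rw [← h0] at hn2
      ext i
      have := (Finset.sum_eq_zero_iff_of_nonneg (fun i _ => sq_nonneg (x i - y i))).mp
        (by rw [← hn2]; norm_num) i (Finset.mem_univ i)
      have := pow_eq_zero_iff (two_ne_zero) |>.mp this
      linarith
    rw [hx]
    refine le_trans ?_ le_self_add
    refine le_mul_of_one_le_left zero_le ?_
    rw [ENNReal.one_le_ofReal]
    exact Real.one_le_exp hε0.le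
  set k := ε * σ / n with hkdef
  have hk : Real.sqrt (2 * Real.log (1.25 / δ)) ≤ k := by
    rw [hkdef, le_div_iff₀ hnpos]
    rw [div_le_iff₀ hε0] at hσ_big
    have := mul_le_mul_of_nonneg_left hxy (Real.sqrt_nonneg (2 * Real.log (1.25 / δ)))
    linarith
  set L : (Fin d → ℝ) → ℝ := fun z => ∑ i, (z i - x i) * ((x i - y i) / (σ * n)) with hL
  have hLm : Measurable L := by fun_prop
  have hlaw := gm_law d v x (fun i => (x i - y i) / (σ * n)) (by
    simp_rw [div_pow]
    rw [← Finset.sum_mul, ← Finset.sum_div, ← hn2, hvσ]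
    field_simp)
  set B : Set (Fin d → ℝ) := L ⁻¹' Set.Ioi (k - ε / (2 * k)) with hB
  have hBm : MeasurableSet B := hLm measurableSet_Ioi
  have hμB : (Measure.pi fun i => gaussianReal (x i) v) B ≤ ENNReal.ofReal δ := by
    rw [hB, ← Measure.map_apply hLm measurableSet_Ioi, hlaw]
    exact gm_num ε δ k hε hδ hk
  have hμE : (Measure.pi fun i => gaussianReal (x i) v) (E \ B) ≤
      ENNReal.ofReal (Real.exp ε) * (Measure.pi fun i => gaussianReal (y i) v) E := by
    rw [gm_density d v hv0 x y, withDensity_apply _ (hE.diff hBm)]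
    calc _ ≤ ∫⁻ z in E \ B, ENNReal.ofReal (Real.exp ε)
            ∂(Measure.pi fun i => gaussianReal (y i) v) := by
          refine setLIntegral_mono' (hE.diff hBm) fun z hz => ?_
          rw [← ENNReal.ofReal_prod_of_nonneg (fun i _ => (Real.exp_pos _).le), ← Real.exp_sum]
          apply ENNReal.ofReal_le_ofReal
          apply Real.exp_le_exp.mpr
          have hz2 : L z ≤ k - ε / (2 * k) := not_lt.mp hz.2
          have hs : ∑ i, ((z i - y i) ^ 2 - (z i - x i) ^ 2) / (2 * (v : ℝ))
              = (n / σ) * L z + n ^ 2 / (2 * σ ^ 2) := by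
            rw [hL, hn2, hvσ, Finset.mul_sum, Finset.sum_div, ← Finset.sum_add_distrib]
            refine Finset.sum_congr rfl fun i _ => ?_
            field_simp
            ring
          rw [hs]
          have h1 : (n / σ) * L z ≤ (n / σ) * (k - ε / (2 * k)) :=
            mul_le_mul_of_nonneg_left hz2 (by positivity)
          have h2 : (n / σ) * (k - ε / (2 * k)) + n ^ 2 / (2 * σ ^ 2) = ε := by
            rw [hkdef]
            field_simp
            ring
          linarith
      _ = ENNReal.ofReal (Real.exp ε) * (Measure.pi fun i => gaussianReal (y i) v) (E \ B) := by
          rw [setLIntegral_const]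
      _ ≤ _ := by
          gcongr
          exact Set.sdiff_subset
  calc _ ≤ (Measure.pi fun i => gaussianReal (x i) v) ((E \ B) ∪ B) :=
        measure_mono (by intro z hz; by_cases h : z ∈ B; exacts [Or.inr h, Or.inl ⟨hz, h⟩])
    _ ≤ _ := (measure_union_le _ _).trans (add_le_add hμE hμB)
end

section
/- Augmented differentially-private SGD (Theorem 2 of the paper): fix a dimension d ≥ 1, real numbers ε ∈ (0, 1), δ ∈ (0, 1), Δ > 0, and σ_target > 0 with σ_target ≥ √(2 ln(1.25/δ)) · Δ / ε. Let 0 ≤ σ_i ≤ σ_target and set σ_augment = √(σ_target² − σ_i²). Let w̄, w̄' : Fin d → ℝ satisfy √(Σᵢ (w̄ᵢ − w̄'ᵢ)²) ≤ Δ. Let μ (resp. μ') be the convolution of the Gaussian product measure on ℝ^d with mean w̄ (resp. w̄') and covariance σ_i²·I with the Gaussian product measure with mean 0 and covariance σ_augment²·I, i.e. the law of the trained weights with intrinsic noise σ_i plus independent added noise σ_augment. Then for every measurable set E ⊆ ℝ^d, μ(E) ≤ e^ε · μ'(E) + δ. -/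
open MeasureTheory ProbabilityTheory

lemma aux_pi_conv {d : ℕ} (μ ν : Fin d → Measure ℝ) [∀ i, IsProbabilityMeasure (μ i)]
    [∀ i, IsProbabilityMeasure (ν i)] :
    (Measure.pi μ).conv (Measure.pi ν) = Measure.pi fun i => (μ i).conv (ν i) := by
  have h := (measurePreserving_arrowProdEquivProdArrow ℝ ℝ (Fin d) μ ν).map_eq
  unfold Measure.conv
  rw [← h, Measure.map_map (by fun_prop) (MeasurableEquiv.measurable _)]
  have : ∀ i, IsProbabilityMeasure (((μ i).prod (ν i)).map fun x : ℝ × ℝ => x.1 + x.2) :=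
    fun i => Measure.isProbabilityMeasure_map (by fun_prop)
  rw [← Measure.pi_map_pi (fun i => by fun_prop)]
  rfl

lemma aux_pi_withDensity {d : ℕ} (μ ν : Fin d → Measure ℝ) [∀ i, IsProbabilityMeasure (μ i)]
    [∀ i, IsProbabilityMeasure (ν i)] (f : Fin d → ℝ → ENNReal) (hf : ∀ i, Measurable (f i))
    (h : ∀ i, ν i = (μ i).withDensity (f i)) :
    Measure.pi ν = (Measure.pi μ).withDensity (fun x => ∏ i, f i (x i)) := by
  refine Measure.pi_eq fun s hs => ?_
  rw [withDensity_apply _ (MeasurableSet.univ_pi hs), ← lintegral_indicator (MeasurableSet.univ_pi hs)]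
  have hm : ∀ i, Measurable ((s i).indicator (f i)) := fun i => (hf i).indicator (hs i)
  have h1 : ∀ x : Fin d → ℝ, (Set.univ.pi s).indicator (fun x => ∏ i, f i (x i)) x
      = ∏ i, (s i).indicator (f i) (x i) := by
    intro x
    by_cases hx : x ∈ Set.univ.pi s
    · rw [Set.indicator_of_mem hx]
      refine Finset.prod_congr rfl fun i _ => ?_
      rw [Set.indicator_of_mem (hx i trivial)]
    · rw [Set.indicator_of_notMem hx]
      simp only [Set.mem_pi, Set.mem_univ, true_imp_iff, not_forall] at hx
      obtain ⟨i, hi⟩ := hx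
      exact (Finset.prod_eq_zero (Finset.mem_univ i) (Set.indicator_of_notMem hi _)).symm
  simp_rw [h1]
  rw [lintegral_prod_eq_prod_lintegral_of_indepFun Finset.univ
    (fun i (x : Fin d → ℝ) => (s i).indicator (f i) (x i))
    (iIndepFun_pi (fun i => (hm i).aemeasurable)) (fun i => (hm i).comp (measurable_pi_apply i))]
  refine Finset.prod_congr rfl fun i _ => ?_
  rw [h i, withDensity_apply _ (hs i), ← lintegral_indicator (hs i)]
  exact (measurePreserving_eval μ i).lintegral_comp (hm i)

lemma aux_gauss (m m' : ℝ) (v : NNReal) (hv : v ≠ 0) :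
    gaussianReal m v = (gaussianReal m' v).withDensity
      (fun x => ENNReal.ofReal (Real.exp (((m - m') * x - (m ^ 2 - m' ^ 2) / 2) / v))) := by
  rw [gaussianReal_of_var_ne_zero _ hv, gaussianReal_of_var_ne_zero _ hv,
    ← withDensity_mul _ (measurable_gaussianPDF _ _) (by fun_prop)]
  congr 1
  ext x
  simp only [Pi.mul_apply, gaussianPDF]
  rw [← ENNReal.ofReal_mul (gaussianPDFReal_nonneg _ _ _), gaussianPDFReal, gaussianPDFReal,
    mul_assoc (√(2 * Real.pi * (v : ℝ)))⁻¹, ← Real.exp_add]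
  have : (v : ℝ) ≠ 0 := by exact_mod_cast hv
  congr 3
  field_simp
  ring

lemma aux_pi_gauss {d : ℕ} (m m' : Fin d → ℝ) (v : NNReal) (hv : v ≠ 0) :
    (Measure.pi fun i => gaussianReal (m i) v) = (Measure.pi fun i => gaussianReal (m' i) v).withDensity
      (fun x => ENNReal.ofReal
        (Real.exp (∑ i, ((m i - m' i) * x i - (m i ^ 2 - m' i ^ 2) / 2) / v))) := by
  rw [aux_pi_withDensity (fun i => gaussianReal (m' i) v) (fun i => gaussianReal (m i) v)
    _ (fun i => by fun_prop) (fun i => aux_gauss (m i) (m' i) v hv)]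
  congr 1
  ext x
  rw [Real.exp_sum, ENNReal.ofReal_prod_of_nonneg (fun i _ => (Real.exp_pos _).le)]

lemma aux_bern (l y : ℝ) (hl : 0 ≤ l) : (1 + l) * (1 - Real.exp (-y)) ≤ Real.exp (l * y) := by
  have h1 := Real.add_one_le_exp (l * y)
  have h2 := Real.add_one_le_exp (-y)
  have h3 := Real.exp_pos (-y)
  rcases le_total y 1 with hy | hy
  · nlinarith
  · nlinarith

lemma aux_const (ε δ S v Δ σ : ℝ) (hε : ε ∈ Set.Ioo (0 : ℝ) 1) (hδ : δ ∈ Set.Ioo (0 : ℝ) 1)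
    (hΔ : 0 < Δ) (hσ : 0 < σ) (hv : v = σ ^ 2)
    (hbig : Real.sqrt (2 * Real.log (1.25 / δ)) * Δ / ε ≤ σ) 
    (hS : Real.sqrt S ≤ Δ) :
    ∃ l : ℝ, 0 ≤ l ∧
      Real.exp (-l * ε + l * (1 + l) * S / (2 * v)) / (1 + l) ≤ δ := by
  obtain ⟨hε0, hε1⟩ := hε
  obtain ⟨hδ0, hδ1⟩ := hδ
  set C := 2 * Real.log (1.25 / δ) with hC
  have hC1 : 0.4 ≤ C := by
    have h1 : Real.log (1.25 / δ) ≥ 1 - (1.25 / δ)⁻¹ :=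
      Real.one_sub_inv_le_log_of_pos (by positivity)
    have h2 : (1.25 / δ)⁻¹ = δ * 0.8 := by
      rw [inv_div]; norm_num; ring
    rw [h2] at h1
    linarith
  have hC0 : 0 < C := by linarith
  have hSD : S ≤ Δ ^ 2 := (Real.sqrt_le_left hΔ.le).1 hS
  have hCS : C * S ≤ ε ^ 2 * v := by
    rw [div_le_iff₀ hε0] at hbig
    have h3 : (Real.sqrt C * Δ) ^ 2 ≤ (σ * ε) ^ 2 := by gcongr
    rw [mul_pow, Real.sq_sqrt hC0.le] at h3
    subst hv
    nlinarith
  have hv0 : 0 < v := by rw [hv]; positivity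
  have hexpC : Real.exp (-(C / 2)) = δ / 1.25 := by
    rw [hC, mul_div_cancel_left₀ _ (by norm_num), Real.exp_neg, Real.exp_log (by positivity), inv_div]
  refine ⟨C / ε, by positivity, ?_⟩
  have hl : C ≤ C / ε := by rw [le_div_iff₀ hε0]; nlinarith
  have h4 : C / ε * (1 + C / ε) * S / (2 * v) ≤ (ε + C) / 2 := by
    rw [div_le_iff₀ (by positivity)]
    have : C / ε * (1 + C / ε) * S = (ε + C) / ε ^ 2 * (C * S) := by field_simp
    rw [this]
    calc (ε + C) / ε ^ 2 * (C * S) ≤ (ε + C) / ε ^ 2 * (ε ^ 2 * v) := by gcongr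
      _ = _ := by field_simp
  have h5 : -(C / ε) * ε + C / ε * (1 + C / ε) * S / (2 * v) ≤ -(C / 2) + 1 / 2 := by
    have : -(C / ε) * ε = -C := by field_simp
    rw [this]; linarith
  have h6 : Real.exp (1 / 2) ≤ 1.75 := by
    have h7 : Real.exp (1 / 2) ^ 2 = Real.exp 1 := by rw [← Real.exp_nat_mul]; norm_num
    have := Real.exp_one_lt_d9
    by_contra! h
    nlinarith
  rw [div_le_iff₀ (by positivity)]
  calc _ ≤ Real.exp (-(C / 2) + 1 / 2) := Real.exp_le_exp.2 h5
    _ = δ / 1.25 * Real.exp (1 / 2) := by rw [Real.exp_add, hexpC]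
    _ ≤ δ / 1.25 * 1.75 := by gcongr
    _ = δ * (1 + 0.4) := by ring
    _ ≤ _ := by gcongr; linarith

lemma aux_main {d : ℕ} (ε δ l : ℝ) (v : NNReal) (hv : v ≠ 0) (hδ : 0 ≤ δ) (w w' : Fin d → ℝ)
    (hl : 0 ≤ l)
    (hc : Real.exp (-l * ε + l * (1 + l) * (∑ i, (w i - w' i) ^ 2) / (2 * v)) / (1 + l) ≤ δ)
    (E : Set (Fin d → ℝ)) (hE : MeasurableSet E) :
    (Measure.pi fun i => gaussianReal (w i) v) E ≤
      ENNReal.ofReal (Real.exp ε) * (Measure.pi fun i => gaussianReal (w' i) v) E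
        + ENNReal.ofReal δ := by
  have hv' : (v : ℝ) ≠ 0 := by exact_mod_cast hv
  set Q := Measure.pi fun i => gaussianReal (w' i) v with hQ
  set u : Fin d → ℝ := fun i => (1 + l) * w i - l * w' i with hu
  set L : (Fin d → ℝ) → ℝ := fun x =>
    ∑ i, ((w i - w' i) * x i - (w i ^ 2 - w' i ^ 2) / 2) / v with hL
  set M : (Fin d → ℝ) → ℝ := fun x =>
    ∑ i, ((u i - w' i) * x i - (u i ^ 2 - w' i ^ 2) / 2) / v with hM
  have hLm : Measurable L := by fun_prop
  have hMm : Measurable M := by fun_prop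
  have hP : (Measure.pi fun i => gaussianReal (w i) v)
      = Q.withDensity (fun x => ENNReal.ofReal (Real.exp (L x))) := aux_pi_gauss w w' v hv
  have hR : (Measure.pi fun i => gaussianReal (u i) v)
      = Q.withDensity (fun x => ENNReal.ofReal (Real.exp (M x))) := aux_pi_gauss u w' v hv
  have hML : ∀ x, M x = (1 + l) * L x - l * (1 + l) * (∑ i, (w i - w' i) ^ 2) / (2 * v) := by
    intro x
    simp only [hM, hL, hu, Finset.mul_sum, Finset.sum_div]
    rw [← Finset.sum_sub_distrib]
    refine Finset.sum_congr rfl fun i _ => ?_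
    field_simp
    ring
  have hpt : ∀ x, Real.exp (L x) ≤ Real.exp ε + δ * Real.exp (M x) := by
    intro x
    have h1 := aux_bern l (L x - ε) hl
    have h2 : Real.exp (L x) * Real.exp (-(L x - ε)) = Real.exp ε := by
      rw [← Real.exp_add]; congr 1; ring
    have h3 : Real.exp (L x) * Real.exp (l * (L x - ε)) =
        Real.exp (-l * ε + l * (1 + l) * (∑ i, (w i - w' i) ^ 2) / (2 * v)) * Real.exp (M x) := by
      rw [← Real.exp_add, ← Real.exp_add, hML]; congr 1; ring
    have h4 := mul_le_mul_of_nonneg_left h1 (Real.exp_pos (L x)).le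
    rw [h3] at h4
    rw [div_le_iff₀ (by positivity)] at hc
    have h5 := mul_le_mul_of_nonneg_right hc (Real.exp_pos (M x)).le
    have h6 : (1 + l) * (Real.exp (L x) - Real.exp ε) ≤ (1 + l) * (δ * Real.exp (M x)) := by
      rw [← h2]; linarith
    have := le_of_mul_le_mul_left h6 (by positivity)
    linarith
  have hR1 : ∫⁻ x in E, ENNReal.ofReal (Real.exp (M x)) ∂Q ≤ 1 := by
    rw [← withDensity_apply _ hE, ← hR]
    exact prob_le_one
  rw [hP, withDensity_apply _ hE]
  calc ∫⁻ x in E, ENNReal.ofReal (Real.exp (L x)) ∂Q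
      ≤ ∫⁻ x in E, (ENNReal.ofReal (Real.exp ε)
          + ENNReal.ofReal δ * ENNReal.ofReal (Real.exp (M x))) ∂Q := by
        refine lintegral_mono fun x => ?_
        rw [← ENNReal.ofReal_mul hδ, ← ENNReal.ofReal_add (Real.exp_pos _).le (by positivity)]
        exact ENNReal.ofReal_le_ofReal (hpt x)
    _ = ENNReal.ofReal (Real.exp ε) * Q E
          + ENNReal.ofReal δ * ∫⁻ x in E, ENNReal.ofReal (Real.exp (M x)) ∂Q := by
        rw [lintegral_add_left (by fun_prop), lintegral_const_mul _ (by fun_prop)]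
        simp
    _ ≤ ENNReal.ofReal (Real.exp ε) * Q E + ENNReal.ofReal δ * 1 := by gcongr
    _ = _ := by rw [mul_one]

lemma aux_conv {d : ℕ} (ε δ l : ℝ) (a b : NNReal) (t : ℝ) (hs : (a : ℝ) + b = t) (ht : 0 < t)
    (hδ : 0 ≤ δ) (w w' : Fin d → ℝ) (hl : 0 ≤ l)
    (hc : Real.exp (-l * ε + l * (1 + l) * (∑ i, (w i - w' i) ^ 2) / (2 * t)) / (1 + l) ≤ δ)
    (E : Set (Fin d → ℝ)) (hE : MeasurableSet E) :
    ((Measure.pi fun i => gaussianReal (w i) a).conv (Measure.pi fun _ => gaussianReal 0 b)) E ≤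
      ENNReal.ofReal (Real.exp ε) *
        ((Measure.pi fun i => gaussianReal (w' i) a).conv
          (Measure.pi fun _ => gaussianReal 0 b)) E
        + ENNReal.ofReal δ := by
  rw [aux_pi_conv, aux_pi_conv]
  simp only [gaussianReal_conv_gaussianReal, add_zero]
  have hv : a + b ≠ 0 := by
    intro h
    have h' : ((a + b : NNReal) : ℝ) = 0 := by rw [h]; rfl
    push_cast at h'
    linarith
  refine aux_main ε δ l _ hv hδ w w' hl ?_ E hE
  push_cast
  rw [hs]
  exact hc

/-- **Augmented differentially-private SGD is (ε, δ)-DP.** Assuming SGD is a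
Gaussian mechanism with intrinsic noise `σᵢ`, adding independent Gaussian noise
with standard deviation `σ_augment = √(σ_target² − σᵢ²)` yields total noise
`σ_target ≥ √(2 ln(1.25/δ)) Δ / ε`, so the released weights satisfy the
`(ε, δ)`-differential-privacy inequality of the Gaussian mechanism. -/
theorem augmented_dp_sgd
    (d : ℕ) (hd : 1 ≤ d) (ε δ Δ σtarget σi : ℝ)
    (hε : ε ∈ Set.Ioo (0 : ℝ) 1) (hδ : δ ∈ Set.Ioo (0 : ℝ) 1)
    (hΔ : 0 < Δ) (hσt : 0 < σtarget)
    (hσt_big : Real.sqrt (2 * Real.log (1.25 / δ)) * Δ / ε ≤ σtarget)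
    (hσi0 : 0 ≤ σi) (hσi : σi ≤ σtarget)
    (σaugment : ℝ) (hσa : σaugment = Real.sqrt (σtarget ^ 2 - σi ^ 2))
    (wbar wbar' : Fin d → ℝ)
    (hsens : Real.sqrt (∑ i, (wbar i - wbar' i) ^ 2) ≤ Δ) :
    ∀ E : Set (Fin d → ℝ), MeasurableSet E →
      ((Measure.pi fun i => gaussianReal (wbar i) ⟨σi ^ 2, sq_nonneg σi⟩).conv
          (Measure.pi fun _ => gaussianReal 0 ⟨σaugment ^ 2, sq_nonneg σaugment⟩)) E ≤
        ENNReal.ofReal (Real.exp ε) *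
          ((Measure.pi fun i => gaussianReal (wbar' i) ⟨σi ^ 2, sq_nonneg σi⟩).conv
            (Measure.pi fun _ => gaussianReal 0 ⟨σaugment ^ 2, sq_nonneg σaugment⟩)) E
          + ENNReal.ofReal δ := by
  intro E hE
  obtain ⟨l, hl, hc⟩ := aux_const ε δ (∑ i, (wbar i - wbar' i) ^ 2) (σtarget ^ 2) Δ σtarget
    hε hδ hΔ hσt rfl hσt_big hsens
  have hs : σi ^ 2 + σaugment ^ 2 = σtarget ^ 2 := by
    rw [hσa, Real.sq_sqrt (by nlinarith)]
    ring
  have hpos : 0 < σtarget ^ 2 := by positivity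
  refine aux_conv ε δ l ⟨σi ^ 2, sq_nonneg σi⟩ ⟨σaugment ^ 2, sq_nonneg σaugment⟩
    (σtarget ^ 2) hs hpos hδ.1.le wbar wbar' hl hc E hE
end
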